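/- arXiv:2211.03392 — 3 statements merged into one kernel-verified Lean document; each statement's English description precedes it below -/
import Mathlib

section
/- Let C be a quasi-cyclic code of length n = lm and index l over F_q for which the multiplier μ_q, the shift ρ^l and all scalar multiplications σ_a (a ∈ F_q^*) lie in Aut(C), where gcd(m,q) = 1 and m' is the multiplicative order of q modulo m. Then the subgroup ⟨μ_q, ρ^l, M⟩ of Aut(C) has order m'·m·(q−1), and each element of ⟨μ_q, ρ^l, M⟩ can be written uniquely as a product μ_q^{r₁} ρ^{r₂l} σ_a for some 0 ≤ r₁ ≤ m'−1, 0 ≤ r₂ ≤ m−1 and a ∈ F_q^*. -/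
/-- The shift `ρ^l` on `F^{lm}`, with a codeword indexed as `c (i, j) = c_{ij}`
(`i ∈ ZMod m` the block index, `j ∈ Fin l` the position inside a block):
`(ρ^l c) (i, j) = c (i - 1, j)`. -/
noncomputable def shiftQC (F : Type*) [Field F] (m l : ℕ) :
    ((ZMod m × Fin l) → F) ≃ₗ[F] ((ZMod m × Fin l) → F) :=
  LinearEquiv.funCongrLeft F F ((Equiv.subRight (1 : ZMod m)).prodCongr (Equiv.refl (Fin l)))

/-- The multiplier `μ_q` on `F^{lm}` determined by the unit `u = q` of `ZMod m`:
under the identification with `R_m^l` it sends `Σ c_i x^i ↦ Σ c_i x^{q i}` in every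
component, i.e. `(μ_q c) (i, j) = c (q⁻¹ i, j)`. -/
noncomputable def multiplierQC (F : Type*) [Field F] (m l : ℕ) (u : (ZMod m)ˣ) :
    ((ZMod m × Fin l) → F) ≃ₗ[F] ((ZMod m × Fin l) → F) :=
  LinearEquiv.funCongrLeft F F ((MulAction.toPerm u⁻¹).prodCongr (Equiv.refl (Fin l)))

/-- The scalar multiplication `σ_a : c ↦ a • c` as a linear automorphism of `F^ι`. -/
noncomputable def scalarEquiv (F : Type*) [Field F] (ι : Type*) (a : Fˣ) :
    (ι → F) ≃ₗ[F] (ι → F) := DistribMulAction.toLinearEquiv F (ι → F) a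

section MonomialAction

variable {F : Type*} [Field F] {m l : ℕ}

theorem shiftQC_pow_apply (k : ℕ) (c : ZMod m × Fin l → F) (i : ZMod m) (j : Fin l) :
    (shiftQC F m l ^ k) c (i, j) = c (i - k, j) := by
  induction k generalizing c with
  | zero => simp
  | succ k ih =>
    rw [pow_succ, LinearEquiv.mul_apply, ih]
    simp [shiftQC, LinearEquiv.funCongrLeft_apply, LinearMap.funLeft_apply, sub_sub]

theorem multiplierQC_pow_apply (u : (ZMod m)ˣ) (k : ℕ) (c : ZMod m × Fin l → F) (i : ZMod m)
    (j : Fin l) :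
    (multiplierQC F m l u ^ k) c (i, j) = c (((u ^ k)⁻¹ : (ZMod m)ˣ) * i, j) := by
  induction k generalizing c with
  | zero => simp
  | succ k ih =>
    rw [pow_succ, LinearEquiv.mul_apply, ih]
    simp [multiplierQC, LinearEquiv.funCongrLeft_apply, LinearMap.funLeft_apply, pow_succ,
      Units.smul_def, mul_assoc]

theorem scalarEquiv_apply {ι : Type*} (a : Fˣ) (c : ι → F) (i : ι) :
    scalarEquiv F ι a c i = a * c i := rfl

theorem multiplier_shift_scalar_apply (u : (ZMod m)ˣ) (r s : ℕ) (a : Fˣ)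
    (c : ZMod m × Fin l → F) (i : ZMod m) (j : Fin l) :
    (multiplierQC F m l u ^ r * shiftQC F m l ^ s * scalarEquiv F (ZMod m × Fin l) a) c (i, j) =
      a * c (((u ^ r)⁻¹ : (ZMod m)ˣ) * i - s, j) := by
  rw [LinearEquiv.mul_apply, LinearEquiv.mul_apply, multiplierQC_pow_apply, shiftQC_pow_apply,
    scalarEquiv_apply]

/-- Every element of the group generated by the multiplier, the shift and the scalars acts by an
affine substitution of the block index followed by a scalar multiplication. -/
theorem exists_affine_of_mem_closure (u : (ZMod m)ˣ)
    {g : (ZMod m × Fin l → F) ≃ₗ[F] (ZMod m × Fin l → F)}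
    (hg : g ∈ Subgroup.closure ({multiplierQC F m l u, shiftQC F m l} ∪
      Set.range (scalarEquiv F (ZMod m × Fin l)))) :
    ∃ v ∈ Subgroup.zpowers u, ∃ (s : ZMod m) (a : Fˣ), ∀ c i j,
      g c (i, j) = a * c ((v⁻¹ : (ZMod m)ˣ) * i - s, j) := by
  induction hg using Subgroup.closure_induction with
  | mem g hg =>
    rcases hg with (rfl | rfl) | ⟨a, rfl⟩
    · refine ⟨u, Subgroup.mem_zpowers u, 0, 1, fun c i j => ?_⟩
      simpa using multiplierQC_pow_apply u 1 c i j
    · refine ⟨1, one_mem _, 1, 1, fun c i j => ?_⟩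
      simpa using shiftQC_pow_apply 1 c i j
    · refine ⟨1, one_mem _, 0, a, fun c i j => ?_⟩
      simp [scalarEquiv_apply]
  | one => exact ⟨1, one_mem _, 0, 1, fun c i j => by simp⟩
  | mul g g' _ _ ih ih' =>
    obtain ⟨v, hv, s, a, h⟩ := ih
    obtain ⟨v', hv', s', a', h'⟩ := ih'
    refine ⟨v * v', mul_mem hv hv', (v'⁻¹ : (ZMod m)ˣ) * s + s', a * a', fun c i j => ?_⟩
    rw [LinearEquiv.mul_apply, h, h', mul_inv_rev]
    push_cast
    rw [mul_assoc]
    congr 4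
    ring
  | inv g _ ih =>
    obtain ⟨v, hv, s, a, h⟩ := ih
    refine ⟨v⁻¹, inv_mem hv, -(v * s), a⁻¹, fun c i j => ?_⟩
    have hc : g (g⁻¹ c) = c := by rw [← LinearEquiv.mul_apply, mul_inv_cancel]; rfl
    conv_rhs => rw [← hc, h]
    rw [Units.inv_mul_cancel_left, inv_inv]
    rw [sub_neg_eq_add, ← mul_add, Units.inv_mul_cancel_left, add_sub_cancel_right]

/-- The scalar and the affine substitution are determined by the resulting map on codewords. -/
theorem affine_action_injective [Nonempty (Fin l)] {v v' : (ZMod m)ˣ} {s s' : ZMod m} {a a' : Fˣ}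
    (h : ∀ (c : ZMod m × Fin l → F) i j,
      (a : F) * c (v * i - s, j) = a' * c (v' * i - s', j)) :
    v = v' ∧ s = s' ∧ a = a' := by
  obtain ⟨j⟩ := ‹Nonempty (Fin l)›
  have ha : a = a' := Units.ext (by simpa using h (fun _ => 1) 0 j)
  subst ha
  have key (i : ZMod m) : (v : ZMod m) * i - s = v' * i - s' := by
    classical
    have := h (Pi.single (v * i - s, j) 1) i j
    by_contra hne
    rw [Pi.single_eq_same, Pi.single_eq_of_ne (fun e => hne (congrArg Prod.fst e).symm)] at this
    simp at this
  have hs : s = s' := by simpa using key 0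
  subst hs
  exact ⟨Units.ext (by simpa using key 1), rfl, rfl⟩

end MonomialAction

/-- Let `C` be a quasi-cyclic code of length `n = lm` and index `l` over
`F_q` (with `gcd(m,q) = 1`, `l ≥ 2`) for which `μ_q`, `ρ^l` and all scalar multiplications
lie in `Aut(C)`, and let `m'` be the multiplicative order of `q` modulo `m`.  Then the
subgroup `⟨μ_q, ρ^l, M⟩` has order `m' · m · (q - 1)`, and each of its elements is uniquely
of the form `μ_q^{r₁} ρ^{r₂ l} σ_a` with `0 ≤ r₁ ≤ m' - 1`, `0 ≤ r₂ ≤ m - 1`, `a ∈ Fˣ`. -/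
theorem multiplier_shift_scalar_group_card {F : Type*} [Field F] [Fintype F] {m l : ℕ}
    [NeZero m] (hl : 2 ≤ l) (hco : Nat.Coprime m (Fintype.card F))
    (u : (ZMod m)ˣ) (hu : u = ZMod.unitOfCoprime (Fintype.card F) hco.symm)
    (m' : ℕ) (hm' : m' = orderOf u)
    (C : Submodule F ((ZMod m × Fin l) → F))
    (hQC : ∀ c ∈ C, shiftQC F m l c ∈ C)
    (hμ : ∀ c ∈ C, multiplierQC F m l u c ∈ C) :
    Nat.card ↥(Subgroup.closure ({multiplierQC F m l u, shiftQC F m l} ∪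
        Set.range (scalarEquiv F (ZMod m × Fin l)))) =
      m' * m * (Fintype.card F - 1) ∧
    ∀ g ∈ Subgroup.closure ({multiplierQC F m l u, shiftQC F m l} ∪
        Set.range (scalarEquiv F (ZMod m × Fin l))),
      ∃! t : Fin m' × Fin m × Fˣ,
        g = multiplierQC F m l u ^ (t.1 : ℕ) * shiftQC F m l ^ (t.2.1 : ℕ) *
          scalarEquiv F (ZMod m × Fin l) t.2.2 := by
  subst hm'
  have : Nonempty (Fin l) := ⟨⟨0, by omega⟩⟩
  set H := Subgroup.closure ({multiplierQC F m l u, shiftQC F m l} ∪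
    Set.range (scalarEquiv F (ZMod m × Fin l)))
  have hmem (t : Fin (orderOf u) × Fin m × Fˣ) :
      multiplierQC F m l u ^ (t.1 : ℕ) * shiftQC F m l ^ (t.2.1 : ℕ) *
        scalarEquiv F (ZMod m × Fin l) t.2.2 ∈ H :=
    mul_mem (mul_mem (pow_mem (Subgroup.subset_closure (by simp)) _)
      (pow_mem (Subgroup.subset_closure (by simp)) _)) (Subgroup.subset_closure (by simp))
  have hunique : ∀ g ∈ H, ∃! t : Fin (orderOf u) × Fin m × Fˣ,
      g = multiplierQC F m l u ^ (t.1 : ℕ) * shiftQC F m l ^ (t.2.1 : ℕ) *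
        scalarEquiv F (ZMod m × Fin l) t.2.2 := by
    intro g hg
    refine existsUnique_of_exists_of_unique ?_ ?_
    · obtain ⟨v, hv, s, a, h⟩ := exists_affine_of_mem_closure u hg
      obtain ⟨r, hr, rfl⟩ := (isOfFinOrder_of_finite u).mem_zpowers_iff_mem_range_orderOf.mp hv
        |> Finset.mem_image.mp
      refine ⟨(⟨r, Finset.mem_range.mp hr⟩, ⟨s.val, ZMod.val_lt s⟩, a), ?_⟩
      ext c ⟨i, j⟩
      rw [h, multiplier_shift_scalar_apply, ZMod.natCast_zmod_val]
    · rintro ⟨r, s, a⟩ ⟨r', s', a'⟩ h h'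
      obtain ⟨hr, hs, ha⟩ := affine_action_injective (l := l) (F := F) (v := (u ^ (r : ℕ))⁻¹)
        (v' := (u ^ (r' : ℕ))⁻¹) (s := ((s : ℕ) : ZMod m)) (s' := ((s' : ℕ) : ZMod m))
        (a := a) (a' := a') fun c i j => by
          rw [← multiplier_shift_scalar_apply, ← multiplier_shift_scalar_apply, ← h, ← h']
      have hr : r = r' := Fin.ext (pow_injOn_Iio_orderOf r.2 r'.2 (inv_injective hr))
      have hs : s = s' := by
        rw [ZMod.natCast_eq_natCast_iff'] at hs
        exact Fin.ext (by rwa [Nat.mod_eq_of_lt s.2, Nat.mod_eq_of_lt s'.2] at hs)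
      rw [hr, hs, ha]
  refine ⟨?_, hunique⟩
  have hbij : Function.Bijective
      (fun t : Fin (orderOf u) × Fin m × Fˣ => (⟨_, hmem t⟩ : H)) := by
    refine (Function.bijective_iff_existsUnique _).mpr fun g => ?_
    simpa only [Subtype.ext_iff, eq_comm] using hunique g g.2
  rw [← Nat.card_congr (Equiv.ofBijective _ hbij), Nat.card_prod, Nat.card_prod, Nat.card_fin,
    Nat.card_fin, Nat.card_units, Nat.card_eq_fintype_card, mul_assoc]
end

section
/- Let C be an [lm, K] quasi-cyclic code over F_q which is a linear code over R_m ε_t, where the primitive idempotent ε_t corresponds to the q-cyclotomic coset {i_t, i_t q, …, i_t q^{k−1}} modulo m. Then the number of orbits of ⟨ρ^l⟩ on C* = C \ {0} is equal to gcd(m, i_t)·(q^K − 1)/m. In particular, s(C) ≤ gcd(m, i_t)·(q^K − 1)/m, with equality if and only if for any two nonzero codewords c₁, c₂ ∈ C* with the same Hamming weight there exists an integer i such that ρ^{il}(c₁) = c₂. -/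
/-- The `q`-cyclotomic coset of `i_t` modulo `m`, viewed inside `ZMod m`. -/
def cycCoset (q m it : ℕ) : Set (ZMod m) :=
  {j | ∃ r : ℕ, j = (it : ZMod m) * (q : ZMod m) ^ r}

/-- Evaluation of the polynomial `Σ_i c_i x^i ∈ R_m = F[x]/(x^m - 1)` at `ζ^j`, computed in
an extension field `E` of `F` containing the primitive `m`-th root of unity `ζ`. -/
noncomputable def evalDFT {F E : Type*} [Field F] [Field E] [Algebra F E] {m : ℕ} [NeZero m]
    (ζ : E) (c : ZMod m → F) (j : ZMod m) : E :=
  ∑ i : ZMod m, algebraMap F E (c i) * ζ ^ (i * j).val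

/-- `Σ_i c_i x^i` lies in the minimal ideal `R_m ε_t` of `R_m` associated with the
`q`-cyclotomic coset of `i_t`, i.e. it vanishes at `ζ^j` for every `j` outside the coset. -/
def inMinIdeal {F E : Type*} [Field F] [Field E] [Algebra F E] (q : ℕ) {m : ℕ} [NeZero m]
    (ζ : E) (it : ℕ) (c : ZMod m → F) : Prop :=
  ∀ j : ZMod m, j ∉ cycCoset q m it → evalDFT ζ c j = 0

theorem shiftQC_zpow_apply {F : Type*} [Field F] {m l : ℕ} (z : ℤ)
    (c : (ZMod m × Fin l) → F) (i : ZMod m) (v : Fin l) :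
    (shiftQC F m l ^ z) c (i, v) = c (i - z, v) := by
  have h1 : ∀ (c : (ZMod m × Fin l) → F) (i : ZMod m), shiftQC F m l c (i, v) = c (i - 1, v) :=
    fun _ _ => rfl
  have h2 : ∀ (c : (ZMod m × Fin l) → F) (i : ZMod m),
      (shiftQC F m l)⁻¹ c (i, v) = c (i + 1, v) := by
    intro c i
    have := h1 ((shiftQC F m l)⁻¹ c) (i + 1)
    rw [← LinearEquiv.mul_apply, mul_inv_cancel, add_sub_cancel_right] at this
    exact this.symm
  induction z generalizing i with
  | zero => simp
  | succ n ih =>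
    rw [add_comm, zpow_one_add, LinearEquiv.mul_apply, h1, ih]
    push_cast
    congr 2
    ring
  | pred n ih =>
    rw [sub_eq_neg_add, zpow_add, zpow_neg_one, LinearEquiv.mul_apply, h2, ih]
    push_cast
    congr 2
    ring

theorem hammingNorm_shiftQC_zpow {F : Type*} [Field F] [DecidableEq F] {m l : ℕ} [NeZero m]
    (z : ℤ) (c : (ZMod m × Fin l) → F) :
    hammingNorm ((shiftQC F m l ^ z) c) = hammingNorm c := by
  unfold hammingNorm
  refine Finset.card_equiv ((Equiv.subRight (z : ZMod m)).prodCongr (Equiv.refl (Fin l))) ?_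
  rintro ⟨i, v⟩
  simp [shiftQC_zpow_apply]

section DFT

variable {F E : Type*} [Field F] [Field E] [Algebra F E] {m : ℕ} [NeZero m] {ζ : E}

theorem evalDFT_eq_sum_zmodChar (hζ : IsPrimitiveRoot ζ m) (c : ZMod m → F) (j : ZMod m) :
    evalDFT ζ c j =
      ∑ i : ZMod m, algebraMap F E (c i) * AddChar.zmodChar m hζ.pow_eq_one (i * j) := by
  simp only [evalDFT, AddChar.zmodChar_apply]

theorem evalDFT_injective (hζ : IsPrimitiveRoot ζ m) :
    Function.Injective (evalDFT (F := F) (m := m) ζ) := by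
  intro c d hcd
  set ψ := AddChar.zmodChar m hζ.pow_eq_one with hψ
  have hprim : ψ.IsPrimitive := AddChar.zmodChar_primitive_of_primitive_root m hζ
  have key : ∀ (c : ZMod m → F) (k : ZMod m),
      ∑ j, evalDFT ζ c j * ψ (j * -k) = (m : E) * algebraMap F E (c k) := by
    intro c k
    simp_rw [evalDFT_eq_sum_zmodChar hζ, Finset.sum_mul]
    rw [Finset.sum_comm]
    have : ∀ i, ∑ j, algebraMap F E (c i) * ψ (i * j) * ψ (j * -k) =
        algebraMap F E (c i) * if i - k = 0 then (m : E) else 0 := by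
      intro i
      have := AddChar.sum_mulShift (i - k) hprim
      rw [ZMod.card] at this
      push_cast at this
      rw [← this, Finset.mul_sum]
      refine Finset.sum_congr rfl fun j _ => ?_
      rw [mul_assoc, ← AddChar.map_add_eq_mul]
      congr 2
      ring
    simp_rw [← hψ, this, sub_eq_zero]
    simp [mul_comm]
  have hm : (m : E) ≠ 0 := hζ.neZero'.ne
  funext k
  refine (algebraMap F E).injective (mul_left_cancel₀ hm ?_)
  rw [← key, ← key, hcd]

theorem evalDFT_translate (hζ : IsPrimitiveRoot ζ m) (c : ZMod m → F) (a j : ZMod m) :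
    evalDFT ζ (fun i => c (i - a)) j =
      AddChar.zmodChar m hζ.pow_eq_one (a * j) * evalDFT ζ c j := by
  rw [evalDFT_eq_sum_zmodChar hζ, evalDFT_eq_sum_zmodChar hζ, Finset.mul_sum,
    ← Equiv.sum_comp (Equiv.addRight a)]
  refine Finset.sum_congr rfl fun i _ => ?_
  simp only [Equiv.coe_addRight, add_sub_cancel_right, add_mul, AddChar.map_add_eq_mul]
  ring

theorem zmodChar_eq_one_iff (hζ : IsPrimitiveRoot ζ m) (a : ZMod m) :
    AddChar.zmodChar m hζ.pow_eq_one a = 1 ↔ a = 0 := by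
  rw [AddChar.zmodChar_apply, hζ.pow_eq_one_iff_dvd, ← ZMod.natCast_eq_zero_iff,
    ZMod.natCast_zmod_val]

/-- A nonzero codeword supported on a single cyclotomic coset is fixed exactly by the
translations annihilating that coset. -/
theorem shiftQC_zpow_eq_self_iff {l q it : ℕ} (hco : Nat.Coprime m q)
    (hζ : IsPrimitiveRoot ζ m) {c : (ZMod m × Fin l) → F} (hc : c ≠ 0)
    (hmin : ∀ v : Fin l, inMinIdeal q ζ it (fun i : ZMod m => c (i, v))) (z : ℤ) :
    (shiftQC F m l ^ z) c = c ↔ (z : ZMod m) * it = 0 := by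
  have hdft : ∀ v j, evalDFT ζ (fun i => (shiftQC F m l ^ z) c (i, v)) j =
      AddChar.zmodChar m hζ.pow_eq_one (z * j) * evalDFT ζ (fun i => c (i, v)) j := by
    intro v j
    simp only [shiftQC_zpow_apply]
    exact evalDFT_translate hζ (fun i => c (i, v)) z j
  constructor
  · intro h
    have hex : ∃ v j, evalDFT ζ (fun i => c (i, v)) j ≠ 0 := by
      by_contra! hall
      refine hc (funext fun ⟨i, v⟩ => ?_)
      have : (fun i => c (i, v)) = fun _ => (0 : F) := by
        refine evalDFT_injective hζ (funext fun j => ?_)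
        rw [hall]
        simp [evalDFT]
      exact congrFun this i
    obtain ⟨v, j, hj⟩ := hex
    have hmem : j ∈ cycCoset q m it := by
      by_contra hj'
      exact hj (hmin v j hj')
    obtain ⟨r, rfl⟩ := hmem
    have h1 := hdft v (it * (q : ZMod m) ^ r)
    rw [h] at h1
    have h2 := (zmodChar_eq_one_iff hζ _).1 (mul_right_cancel₀ hj (h1.symm.trans (one_mul _).symm))
    rw [← mul_assoc] at h2
    have hu : IsUnit ((q : ZMod m) ^ r) := ((ZMod.isUnit_iff_coprime q m).2 hco.symm).pow r
    exact (hu.mul_left_eq_zero).1 h2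
  · intro h
    funext ⟨i, v⟩
    refine congrFun (evalDFT_injective hζ (funext fun j => ?_) :
      (fun i => (shiftQC F m l ^ z) c (i, v)) = fun i => c (i, v)) i
    rw [hdft]
    by_cases hj : j ∈ cycCoset q m it
    · obtain ⟨r, rfl⟩ := hj
      rw [← mul_assoc, h, zero_mul, AddChar.map_zero_eq_one, one_mul]
    · rw [hmin v j hj, mul_zero]

end DFT

theorem ZMod.intCast_mul_natCast_eq_zero_iff {m : ℕ} [NeZero m] (z : ℤ) (a : ℕ) :
    (z : ZMod m) * a = 0 ↔ ((m / m.gcd a : ℕ) : ℤ) ∣ z := by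
  have hg : 0 < m.gcd a := Nat.gcd_pos_of_pos_left a (NeZero.pos m)
  have hcop : IsCoprime ((m / m.gcd a : ℕ) : ℤ) ((a / m.gcd a : ℕ) : ℤ) :=
    Nat.isCoprime_iff_coprime.2 (Nat.coprime_div_gcd_div_gcd hg)
  have hm : (m : ℤ) = (m.gcd a : ℤ) * (m / m.gcd a : ℕ) := by
    exact_mod_cast (Nat.mul_div_cancel' (Nat.gcd_dvd_left m a)).symm
  have ha : z * (a : ℤ) = (m.gcd a : ℤ) * (z * (a / m.gcd a : ℕ)) := by
    have : (a : ℤ) = (m.gcd a : ℤ) * (a / m.gcd a : ℕ) := by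
      exact_mod_cast (Nat.mul_div_cancel' (Nat.gcd_dvd_right m a)).symm
    linear_combination z * this
  have hcast : (z : ZMod m) * a = ((z * (a : ℤ) : ℤ) : ZMod m) := by push_cast; rfl
  have hg' : (m.gcd a : ℤ) ≠ 0 := by exact_mod_cast hg.ne'
  rw [hcast, ZMod.intCast_zmod_eq_zero_iff_dvd]
  generalize ((m / m.gcd a : ℕ) : ℤ) = n at *
  rw [hm, ha, mul_dvd_mul_iff_left hg']
  exact ⟨hcop.dvd_of_dvd_mul_right, fun h => h.mul_right _⟩

section Orbit

variable {F V : Type*} [Field F] [AddCommGroup V] [Module F V] (σ : V ≃ₗ[F] V)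

theorem setOf_zpow_eq_iff (a b : V) :
    {x | ∃ z : ℤ, (σ ^ z) a = x} = {x | ∃ z : ℤ, (σ ^ z) b = x} ↔ ∃ z : ℤ, (σ ^ z) a = b := by
  constructor
  · intro h
    have : b ∈ {x | ∃ z : ℤ, (σ ^ z) b = x} := ⟨0, by simp⟩
    rwa [← h] at this
  · rintro ⟨w, rfl⟩
    ext x
    constructor
    · rintro ⟨z, rfl⟩
      exact ⟨z - w, by rw [← LinearEquiv.mul_apply, ← zpow_add, sub_add_cancel]⟩
    · rintro ⟨z, rfl⟩
      exact ⟨z + w, by rw [zpow_add, LinearEquiv.mul_apply]⟩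

theorem ncard_setOf_zpow {n : ℕ} (hn : 0 < n) {a : V}
    (h : ∀ z : ℤ, (σ ^ z) a = a ↔ (n : ℤ) ∣ z) :
    {x | ∃ z : ℤ, (σ ^ z) a = x}.ncard = n := by
  have heq : ∀ z w : ℤ, (σ ^ z) a = (σ ^ w) a ↔ (n : ℤ) ∣ z - w := by
    intro z w
    rw [← h, sub_eq_neg_add, zpow_add, LinearEquiv.mul_apply, zpow_neg]
    constructor
    · intro e
      rw [e, ← LinearEquiv.mul_apply, inv_mul_cancel, LinearEquiv.coe_one, id_eq]
    · intro e
      nth_rewrite 2 [← e]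
      rw [← LinearEquiv.mul_apply, mul_inv_cancel, LinearEquiv.coe_one, id_eq]
  have himg : {x | ∃ z : ℤ, (σ ^ z) a = x} =
      (fun z : ℤ => (σ ^ z) a) '' (Finset.Ico (0 : ℤ) n : Set ℤ) := by
    ext x
    constructor
    · rintro ⟨z, rfl⟩
      refine ⟨z % n, ?_, ?_⟩
      · simpa using ⟨Int.emod_nonneg z (by omega), Int.emod_lt_of_pos z (by omega)⟩
      · refine (heq _ _).2 ?_
        rw [← dvd_neg, neg_sub]
        exact Int.dvd_self_sub_emod
    · rintro ⟨z, -, rfl⟩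
      exact ⟨z, rfl⟩
  rw [himg, Set.InjOn.ncard_image, Set.ncard_coe_finset]
  · simp
  · intro z hz w hw e
    simp only [Finset.coe_Ico, Set.mem_Ico] at hz hw
    have hd := (heq z w).1 e
    have := Int.eq_zero_of_abs_lt_dvd hd (by rw [abs_lt]; omega)
    omega

end Orbit

theorem Set.ncard_eq_ncard_image_mul {α β : Type*} {s : Set α} (hs : s.Finite) (f : α → β)
    {n : ℕ} (h : ∀ a ∈ s, {x ∈ s | f x = f a}.ncard = n) :
    s.ncard = (f '' s).ncard * n := by
  classical
  lift s to Finset α using hs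
  rw [← Finset.coe_image, Set.ncard_coe_finset, Set.ncard_coe_finset,
    Finset.card_eq_sum_card_image f s, Finset.sum_const_nat]
  intro b hb
  obtain ⟨a, ha, rfl⟩ := Finset.mem_image.1 hb
  rw [← h a ha, ← Set.ncard_coe_finset]
  congr 1
  ext x
  simp

/-- Let `C` be an `[lm, K]` quasi-cyclic code over `F_q` which is a linear
code over `R_m ε_t`, the primitive idempotent `ε_t` corresponding to the `q`-cyclotomic coset
`{i_t, i_t q, …, i_t q^{k-1}}` modulo `m`.  Then the number of orbits of `⟨ρ^l⟩` on
`C \ {0}` equals `gcd(m, i_t)(q^K - 1)/m`; in particular `s(C)` is at most this number, with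
equality iff any two nonzero codewords of equal weight lie in the same `⟨ρ^l⟩`-orbit. -/
theorem orbits_shift_minimal_ideal {F E : Type*} [Field F] [Fintype F] [DecidableEq F]
    [Field E] [Algebra F E] {m l K k it : ℕ} [NeZero m] (hl : 2 ≤ l)
    (hco : Nat.Coprime m (Fintype.card F))
    (ζ : E) (hζ : IsPrimitiveRoot ζ m)
    (C : Submodule F ((ZMod m × Fin l) → F))
    (hQC : ∀ c ∈ C, shiftQC F m l c ∈ C)
    (hmin : ∀ c ∈ C, ∀ v : Fin l,
      inMinIdeal (Fintype.card F) ζ it (fun i : ZMod m => c (i, v)))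
    (hK : Module.finrank F ↥C = K)
    (hk : (cycCoset (Fintype.card F) m it).ncard = k)
    (N : ℕ)
    (hN : Set.ncard {O : Set ((ZMod m × Fin l) → F) | ∃ c, c ∈ C ∧ c ≠ 0 ∧
      O = {x | ∃ z : ℤ, (shiftQC F m l ^ z) c = x}} = N) :
    (N : ℚ) = (Nat.gcd m it * (Fintype.card F ^ K - 1) : ℕ) / (m : ℚ) ∧
    Set.ncard {w : ℕ | ∃ c, c ∈ C ∧ c ≠ 0 ∧ hammingNorm c = w} ≤ N ∧
    (Set.ncard {w : ℕ | ∃ c, c ∈ C ∧ c ≠ 0 ∧ hammingNorm c = w} = N ↔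
      ∀ c₁ c₂ : (ZMod m × Fin l) → F, c₁ ∈ C → c₂ ∈ C → c₁ ≠ 0 → c₂ ≠ 0 →
        hammingNorm c₁ = hammingNorm c₂ → ∃ z : ℤ, (shiftQC F m l ^ z) c₁ = c₂) := by
  set σ := shiftQC F m l
  set orb : ((ZMod m × Fin l) → F) → Set ((ZMod m × Fin l) → F) :=
    fun c => {x | ∃ z : ℤ, (σ ^ z) c = x} with horb
  set S : Set ((ZMod m × Fin l) → F) := {c | c ∈ C ∧ c ≠ 0} with hS
  have hO : {O : Set ((ZMod m × Fin l) → F) | ∃ c, c ∈ C ∧ c ≠ 0 ∧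
      O = {x | ∃ z : ℤ, (σ ^ z) c = x}} = orb '' S := by
    ext O
    simp [hS, horb, and_assoc, eq_comm]
  have hW : {w : ℕ | ∃ c, c ∈ C ∧ c ≠ 0 ∧ hammingNorm c = w} = hammingNorm '' S := by
    ext w
    simp [hS, and_assoc]
  rw [hO] at hN
  rw [hW]
  have hper : ∀ c ∈ S, ∀ z : ℤ, (σ ^ z) c = c ↔ ((m / m.gcd it : ℕ) : ℤ) ∣ z := fun c hc z =>
    (shiftQC_zpow_eq_self_iff hco hζ hc.2 (hmin c hc.1) z).trans
      (ZMod.intCast_mul_natCast_eq_zero_iff z it)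
  have hgm : m.gcd it * (m / m.gcd it) = m := Nat.mul_div_cancel' (Nat.gcd_dvd_left m it)
  have hn : 0 < m / m.gcd it :=
    Nat.pos_of_ne_zero fun h => NeZero.ne m (by rw [← hgm, h, mul_zero])
  have hinv : ∀ c ∈ C, ∀ z : ℤ, (σ ^ z) c ∈ C := by
    have hnat : ∀ n : ℕ, ∀ c ∈ C, (σ ^ n) c ∈ C := by
      intro n
      induction n with
      | zero => simp
      | succ n ih =>
        intro c hc
        rw [pow_succ, LinearEquiv.mul_apply]
        exact ih _ (hQC c hc)
    intro c hc z
    have hz : (σ ^ z) c = (σ ^ (z % (m : ℤ)).toNat) c := by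
      funext ⟨i, v⟩
      rw [← zpow_natCast σ, Int.toNat_of_nonneg (Int.emod_nonneg z (by simp [NeZero.ne m])),
        shiftQC_zpow_apply, shiftQC_zpow_apply, ZMod.intCast_mod]
    rw [hz]
    exact hnat _ c hc
  have hcard : S.ncard = N * (m / m.gcd it) := by
    rw [← hN]
    refine Set.ncard_eq_ncard_image_mul S.toFinite orb fun a ha => ?_
    rw [← ncard_setOf_zpow σ hn (hper a ha)]
    congr 1
    ext x
    simp only [Set.mem_ofPred_eq]
    rw [← setOf_zpow_eq_iff]
    refine ⟨fun h => h.2.symm, fun h => ⟨?_, h.symm⟩⟩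
    obtain ⟨z, rfl⟩ := (setOf_zpow_eq_iff σ a x).1 h
    exact ⟨hinv a ha.1 z, (σ ^ z).map_ne_zero_iff.2 ha.2⟩
  have hScard : S.ncard = Fintype.card F ^ K - 1 := by
    have hdiff : S = (C : Set ((ZMod m × Fin l) → F)) \ {0} := by
      ext c
      simp [hS]
    rw [hdiff, Set.ncard_sdiff_singleton_of_mem (by simp), ← Nat.card_coe_set_eq,
      ← Nat.card_eq_fintype_card, ← hK]
    congr 1
    exact Module.natCard_eq_pow_finrank (K := F) (V := C)
  obtain ⟨e, he⟩ := (Function.factorsThrough_iff (f := orb)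
    (hammingNorm : ((ZMod m × Fin l) → F) → ℕ)).1 (by
      intro a b hab
      obtain ⟨z, rfl⟩ := (setOf_zpow_eq_iff σ a b).1 hab
      exact (hammingNorm_shiftQC_zpow z a).symm)
  have himg : (hammingNorm : ((ZMod m × Fin l) → F) → ℕ) '' S = e '' (orb '' S) := by
    rw [he, Set.image_comp]
  refine ⟨?_, ?_, ?_⟩
  · have hm : (m : ℚ) ≠ 0 := by exact_mod_cast NeZero.ne m
    rw [eq_div_iff hm, ← hScard, hcard]
    norm_cast
    nth_rewrite 1 [← hgm]
    ring
  · rw [himg, ← hN]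
    exact Set.ncard_image_le (Set.toFinite _)
  · rw [himg, ← hN, Set.ncard_image_iff (Set.toFinite _)]
    constructor
    · intro hinj c₁ c₂ h1 h2 h10 h20 hw
      refine (setOf_zpow_eq_iff σ c₁ c₂).1
        (hinj ⟨c₁, ⟨h1, h10⟩, rfl⟩ ⟨c₂, ⟨h2, h20⟩, rfl⟩ ?_)
      exact (congrFun he c₁).symm.trans (hw.trans (congrFun he c₂))
    · rintro h _ ⟨c₁, h1, rfl⟩ _ ⟨c₂, h2, rfl⟩ hw
      refine (setOf_zpow_eq_iff σ c₁ c₂).2 (h c₁ c₂ h1.1 h2.1 h1.2 h2.2 ?_)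
      exact (congrFun he c₁).trans (hw.trans (congrFun he c₂).symm)
end

section
/- Let C be an [lm, K] quasi-cyclic code over F_q which is a linear code over R_m ε_t, where the primitive idempotent ε_t corresponds to the q-cyclotomic coset {i_t, i_t q, …, i_t q^{k−1}} modulo m. Then the number of orbits of ⟨ρ^l, M⟩ on C* = C \ {0} is equal to gcd(m, (q−1)·i_t)·(q^K − 1)/(m(q−1)). In particular, s(C) ≤ gcd(m, (q−1)·i_t)·(q^K − 1)/(m(q−1)), with equality if and only if for any two nonzero codewords c₁, c₂ ∈ C* with the same Hamming weight there exist an integer i and an element a ∈ F_q^* such that ρ^{il}(a·c₁) = c₂. -/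
namespace QuasiCyclicOrbits

section LinearOrbit

variable {F V : Type*} [Field F] [AddCommGroup V] [Module F V]

/-- The orbit of `c` under the group generated by `T` and the nonzero scalars. -/
def linOrbit (T : V ≃ₗ[F] V) (c : V) : Set V :=
  {x | ∃ (z : ℤ) (a : Fˣ), (T ^ z) ((a : F) • c) = x}

theorem mem_linOrbit_self (T : V ≃ₗ[F] V) (c : V) : c ∈ linOrbit T c :=
  ⟨0, 1, by simp⟩

theorem linOrbit_subset (T : V ≃ₗ[F] V) {c x : V} (hx : x ∈ linOrbit T c) :
    linOrbit T x ⊆ linOrbit T c := by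
  obtain ⟨z, a, rfl⟩ := hx
  rintro _ ⟨w, b, rfl⟩
  refine ⟨w + z, b * a, ?_⟩
  simp [zpow_add, mul_smul]

theorem mem_linOrbit_symm (T : V ≃ₗ[F] V) {c x : V} (hx : x ∈ linOrbit T c) :
    c ∈ linOrbit T x := by
  obtain ⟨z, a, rfl⟩ := hx
  refine ⟨-z, a⁻¹, ?_⟩
  rw [← map_smul, smul_smul, ← LinearEquiv.mul_apply, ← zpow_add]
  simp

theorem linOrbit_eq_iff_mem (T : V ≃ₗ[F] V) {c x : V} :
    linOrbit T x = linOrbit T c ↔ x ∈ linOrbit T c :=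
  ⟨fun h => h ▸ mem_linOrbit_self T x,
    fun h => (linOrbit_subset T h).antisymm (linOrbit_subset T (mem_linOrbit_symm T h))⟩

theorem ncard_linOrbit [Fintype F] (T : V ≃ₗ[F] V) {c : V} (hc : c ≠ 0) {d : ℕ} (hd : 0 < d)
    (h : ∀ z : ℤ, (∃ a : Fˣ, (T ^ z) c = (a : F) • c) ↔ (d : ℤ) ∣ z) :
    (linOrbit T c).ncard = d * (Fintype.card F - 1) := by
  classical
  have key : linOrbit T c =
      (fun p : Fin d × Fˣ => (T ^ ((p.1 : ℕ) : ℤ)) ((p.2 : F) • c)) '' Set.univ := by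
    ext x
    constructor
    · rintro ⟨z, a, rfl⟩
      obtain ⟨b, hb⟩ := (h (d * (z / d))).2 (dvd_mul_right _ _)
      have hd' : (d : ℤ) ≠ 0 := by exact_mod_cast hd.ne'
      have h0 := Int.emod_nonneg z hd'
      have h1 := Int.emod_lt_of_pos z (by exact_mod_cast hd : (0 : ℤ) < d)
      refine ⟨(⟨(z % d).toNat, by omega⟩, a * b), trivial, ?_⟩
      have hz : (((z % d).toNat : ℕ) : ℤ) = z % d := Int.toNat_of_nonneg h0
      conv_rhs => rw [← Int.emod_add_mul_ediv z d, zpow_add, LinearEquiv.mul_apply, map_smul, hb]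
      simp [hz, mul_smul]
    · rintro ⟨p, -, rfl⟩
      exact ⟨_, _, rfl⟩
  have inj : Function.Injective
      (fun p : Fin d × Fˣ => (T ^ ((p.1 : ℕ) : ℤ)) ((p.2 : F) • c)) := by
    rintro ⟨r, a⟩ ⟨s, b⟩ hrs
    simp only at hrs
    have hrs' : (T ^ ((r : ℤ) - s)) c = ((a⁻¹ * b : Fˣ) : F) • c := by
      have := congrArg (fun x => (a⁻¹ : F) • (T ^ (-(s : ℤ))) x) hrs
      simp only [← map_smul, ← LinearEquiv.mul_apply, ← zpow_add, smul_smul] at this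
      rw [neg_add_cancel, inv_mul_cancel₀ a.ne_zero, one_smul, neg_add_eq_sub] at this
      simpa using this
    have hdvd := (h _).1 ⟨_, hrs'⟩
    have hr := r.2
    have hs := s.2
    have hrs0 : (r : ℤ) - s = 0 :=
      Int.eq_zero_of_abs_lt_dvd hdvd (by rw [abs_lt]; omega)
    have e : r = s := by ext; omega
    subst e
    have e2 : (a : F) = b := smul_left_injective F hc ((T ^ ((r : ℕ) : ℤ)).injective hrs)
    rw [Units.ext e2]
  rw [key, Set.ncard_image_of_injective _ inj, Set.ncard_univ, Nat.card_prod,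
    Nat.card_eq_fintype_card, Nat.card_eq_fintype_card, Fintype.card_fin, Fintype.card_units]

theorem ncard_linOrbits_mul [Fintype F] [Finite V] (T : V ≃ₗ[F] V) (C : Submodule F V)
    (hC : ∀ c ∈ C, linOrbit T c ⊆ C) {n : ℕ}
    (hn : ∀ c ∈ C, c ≠ 0 → (linOrbit T c).ncard = n) :
    {O : Set V | ∃ c, c ∈ C ∧ c ≠ 0 ∧ O = linOrbit T c}.ncard * n =
      Fintype.card F ^ Module.finrank F C - 1 := by
  classical
  have := Fintype.ofFinite V
  set S : Finset V := {c | c ∈ C ∧ c ≠ 0} with hS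
  have e : {O : Set V | ∃ c, c ∈ C ∧ c ≠ 0 ∧ O = linOrbit T c} =
      (S.image (linOrbit T) : Finset (Set V)) := by
    ext O
    simp [hS, and_assoc, eq_comm]
  have hcard : S.card = Fintype.card F ^ Module.finrank F C - 1 := by
    rw [← Module.card_eq_pow_finrank (V := C)]
    have : S = (Finset.univ.filter (· ∈ C)).erase 0 := by
      ext; simp [hS, and_comm]
    rw [this, Finset.card_erase_of_mem (by simp), Fintype.card_subtype]
  rw [e, Set.ncard_coe_finset, ← hcard,
    Finset.card_eq_sum_card_fiberwise (f := linOrbit T) (t := S.image (linOrbit T))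
      (fun x hx => Finset.mem_coe.2 (Finset.mem_image_of_mem _ hx))]
  rw [Finset.sum_congr rfl (g := fun _ => n), Finset.sum_const, smul_eq_mul]
  intro O hO
  obtain ⟨c, hc, rfl⟩ := Finset.mem_image.1 hO
  simp only [hS, Finset.mem_filter, Finset.mem_univ, true_and] at hc
  rw [← hn c hc.1 hc.2, ← Set.ncard_coe_finset]
  congr 1
  ext x
  simp only [hS, Finset.coe_filter, Finset.mem_filter, Finset.mem_univ, true_and,
    Set.mem_ofPred_eq, linOrbit_eq_iff_mem]
  refine ⟨fun hx => hx.2, fun hx => ⟨⟨hC c hc.1 hx, ?_⟩, hx⟩⟩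
  rintro rfl
  obtain ⟨z, a, h⟩ := hx
  simp [hc.2] at h

/-- The values of an orbit-invariant function on `S` are at most as many as the orbits, with
equality iff the function separates orbits. -/
theorem ncard_values_le_linOrbits [Finite V] (T : V ≃ₗ[F] V) (P : V → Prop) (w : V → ℕ)
    (hw : ∀ c x, x ∈ linOrbit T c → w x = w c) :
    {n : ℕ | ∃ c, P c ∧ w c = n}.ncard ≤ {O : Set V | ∃ c, P c ∧ O = linOrbit T c}.ncard ∧
    ({n : ℕ | ∃ c, P c ∧ w c = n}.ncard = {O : Set V | ∃ c, P c ∧ O = linOrbit T c}.ncard ↔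
      ∀ c₁ c₂, P c₁ → P c₂ → w c₁ = w c₂ → c₂ ∈ linOrbit T c₁) := by
  have hg : ∀ c, sInf (w '' linOrbit T c) = w c := by
    intro c
    have : w '' linOrbit T c = {w c} :=
      Set.eq_singleton_iff_unique_mem.2
        ⟨⟨c, mem_linOrbit_self T c, rfl⟩, by rintro _ ⟨x, hx, rfl⟩; exact hw c x hx⟩
    simp [this]
  have e : {n : ℕ | ∃ c, P c ∧ w c = n} =
      (fun O : Set V => sInf (w '' O)) '' {O : Set V | ∃ c, P c ∧ O = linOrbit T c} := by
    ext n
    constructor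
    · rintro ⟨c, hc, rfl⟩
      exact ⟨_, ⟨c, hc, rfl⟩, hg c⟩
    · rintro ⟨_, ⟨c, hc, rfl⟩, rfl⟩
      exact ⟨c, hc, (hg c).symm⟩
  rw [e]
  refine ⟨Set.ncard_image_le (Set.toFinite _), (Set.ncard_image_iff (Set.toFinite _)).trans ?_⟩
  constructor
  · intro h c₁ c₂ h₁ h₂ heq
    rw [← linOrbit_eq_iff_mem]
    exact h ⟨c₂, h₂, rfl⟩ ⟨c₁, h₁, rfl⟩ (by simp [hg, heq])
  · rintro h _ ⟨c₁, h₁, rfl⟩ _ ⟨c₂, h₂, rfl⟩ heq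
    simp only [hg] at heq
    exact (linOrbit_eq_iff_mem T).2 (h c₂ c₁ h₂ h₁ heq.symm)

end LinearOrbit

section Shift

variable {F : Type*} [Field F] {m l : ℕ}

theorem shiftQC_apply (c : ZMod m × Fin l → F) (i : ZMod m) (v : Fin l) :
    shiftQC F m l c (i, v) = c (i - 1, v) := rfl

theorem shiftQC_pow_apply (n : ℕ) (c : ZMod m × Fin l → F) (i : ZMod m) (v : Fin l) :
    (shiftQC F m l ^ n) c (i, v) = c (i - n, v) := by
  induction n generalizing c with
  | zero => simp
  | succ n ih => rw [pow_succ, LinearEquiv.mul_apply, ih, shiftQC_apply]; push_cast; ring_nf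

theorem shiftQC_zpow_apply (z : ℤ) (c : ZMod m × Fin l → F) (i : ZMod m) (v : Fin l) :
    (shiftQC F m l ^ z) c (i, v) = c (i - z, v) := by
  obtain ⟨n, rfl | rfl⟩ := z.eq_nat_or_neg
  · simpa using shiftQC_pow_apply n c i v
  · have h := shiftQC_pow_apply n ((shiftQC F m l ^ (-(n : ℤ))) c) (i + n) v
    rw [← zpow_natCast, ← LinearEquiv.mul_apply, ← zpow_add] at h
    simpa using h.symm

theorem shiftQC_zpow_mem [NeZero m] {C : Submodule F (ZMod m × Fin l → F)}
    (hQC : ∀ c ∈ C, shiftQC F m l c ∈ C) (z : ℤ) {c : ZMod m × Fin l → F} (hc : c ∈ C) :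
    (shiftQC F m l ^ z) c ∈ C := by
  have hnat : ∀ n : ℕ, (shiftQC F m l ^ n) c ∈ C := by
    intro n
    induction n with
    | zero => simpa
    | succ n ih => rw [pow_succ', LinearEquiv.mul_apply]; exact hQC _ ih
  convert hnat (z : ZMod m).val using 1
  ext ⟨i, v⟩
  rw [shiftQC_zpow_apply, shiftQC_pow_apply, ZMod.natCast_zmod_val]

theorem hammingNorm_shiftQC_zpow_smul [NeZero m] [DecidableEq F] (z : ℤ) (a : Fˣ)
    (c : ZMod m × Fin l → F) :
    hammingNorm ((shiftQC F m l ^ z) ((a : F) • c)) = hammingNorm c := by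
  refine Finset.card_equiv ((Equiv.subRight (z : ZMod m)).prodCongr (Equiv.refl _)) ?_
  rintro ⟨i, v⟩
  simp [shiftQC_zpow_apply]

end Shift

section DFT

variable {F E : Type*} [Field F] [Field E] [Algebra F E] {m : ℕ} [NeZero m] {ζ : E}

theorem evalDFT_eq_sum_zmodChar (hζ : IsPrimitiveRoot ζ m) (c : ZMod m → F) (j : ZMod m) :
    evalDFT ζ c j =
      ∑ i, algebraMap F E (c i) * AddChar.zmodChar m hζ.pow_eq_one (i * j) := by
  simp [evalDFT, AddChar.zmodChar_apply]

theorem evalDFT_shift (hζ : IsPrimitiveRoot ζ m) (c : ZMod m → F) (s j : ZMod m) :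
    evalDFT ζ (fun i => c (i - s)) j =
      AddChar.zmodChar m hζ.pow_eq_one (s * j) * evalDFT ζ c j := by
  rw [evalDFT_eq_sum_zmodChar hζ, evalDFT_eq_sum_zmodChar hζ, Finset.mul_sum]
  refine Fintype.sum_equiv (Equiv.subRight s) _ _ fun i => ?_
  rw [Equiv.subRight_apply, mul_left_comm, ← AddChar.map_add_eq_mul]
  ring_nf

theorem evalDFT_smul (a : F) (c : ZMod m → F) (j : ZMod m) :
    evalDFT ζ (fun i => a * c i) j = algebraMap F E a * evalDFT ζ c j := by
  simp [evalDFT, Finset.mul_sum, mul_assoc]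

theorem evalDFT_sub (c d : ZMod m → F) (j : ZMod m) :
    evalDFT ζ (fun i => c i - d i) j = evalDFT ζ c j - evalDFT ζ d j := by
  simp [evalDFT, sub_mul]

theorem evalDFT_mul_card [Fintype F] (hζ : IsPrimitiveRoot ζ m) (c : ZMod m → F)
    (j : ZMod m) : evalDFT ζ c (j * Fintype.card F) = evalDFT ζ c j ^ Fintype.card F := by
  rw [← FiniteField.frobeniusAlgHom_apply F E, evalDFT_eq_sum_zmodChar hζ,
    evalDFT_eq_sum_zmodChar hζ, map_sum]
  refine Finset.sum_congr rfl fun i _ => ?_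
  rw [map_mul (FiniteField.frobeniusAlgHom F E), AlgHom.commutes, FiniteField.frobeniusAlgHom_apply, ← AddChar.map_nsmul_eq_pow,
    nsmul_eq_mul]
  ring_nf

theorem evalDFT_mul_card_pow [Fintype F] (hζ : IsPrimitiveRoot ζ m) (c : ZMod m → F)
    (j : ZMod m) (r : ℕ) :
    evalDFT ζ c (j * (Fintype.card F : ZMod m) ^ r) = evalDFT ζ c j ^ Fintype.card F ^ r := by
  induction r with
  | zero => simp
  | succ r ih => rw [pow_succ, ← mul_assoc, evalDFT_mul_card hζ, ih, ← pow_mul, pow_succ]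

theorem eq_zero_of_evalDFT_eq_zero (hζ : IsPrimitiveRoot ζ m) (hm : (m : E) ≠ 0)
    (c : ZMod m → F) (h : ∀ j, evalDFT ζ c j = 0) : c = 0 := by
  ext i₀
  have hsum : ∑ j : ZMod m, AddChar.zmodChar m hζ.pow_eq_one (-(i₀ * j)) * evalDFT ζ c j =
      algebraMap F E (c i₀) * m := by
    simp_rw [evalDFT_eq_sum_zmodChar hζ, Finset.mul_sum]
    rw [Finset.sum_comm, Finset.sum_eq_single i₀]
    · simp_rw [mul_left_comm _ (algebraMap F E _), ← AddChar.map_add_eq_mul]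
      simp [mul_comm]
    · intro i _ hi
      simp_rw [mul_left_comm _ (algebraMap F E _), ← AddChar.map_add_eq_mul, ← Finset.mul_sum]
      have := AddChar.sum_mulShift (i - i₀)
        (AddChar.zmodChar_primitive_of_primitive_root m hζ)
      rw [if_neg (sub_ne_zero.2 hi), Nat.cast_zero] at this
      rw [Finset.sum_congr rfl, this, mul_zero]
      intro j _
      ring_nf
    · simp
  simp only [h, mul_zero, Finset.sum_const_zero] at hsum
  simpa [hm] using hsum.symm

theorem eq_zero_of_inMinIdeal [Fintype F] (hζ : IsPrimitiveRoot ζ m) (hm : (m : E) ≠ 0)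
    {it : ℕ} {c : ZMod m → F} (hc : inMinIdeal (Fintype.card F) ζ it c)
    (h : evalDFT ζ c it = 0) : c = 0 := by
  refine eq_zero_of_evalDFT_eq_zero hζ hm c fun j => ?_
  by_cases hj : j ∈ cycCoset (Fintype.card F) m it
  · obtain ⟨r, rfl⟩ := hj
    rw [evalDFT_mul_card_pow hζ, h, zero_pow (pow_ne_zero _ Fintype.card_ne_zero)]
  · exact hc j hj

end DFT

theorem exists_units_algebraMap_eq_iff {F E : Type*} [Field F] [Fintype F] [Field E]
    [Algebra F E] (x : E) :
    (∃ a : Fˣ, algebraMap F E a = x) ↔ x ^ (Fintype.card F - 1) = 1 := by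
  constructor
  · rintro ⟨a, rfl⟩
    rw [← map_pow, FiniteField.pow_card_sub_one_eq_one _ a.ne_zero, map_one]
  · intro hx
    obtain ⟨g, hg⟩ := IsCyclic.exists_ofOrder_eq_natCard (α := Fˣ)
    have hcard : Nat.card Fˣ = Fintype.card F - 1 := by
      classical rw [Nat.card_eq_fintype_card, Fintype.card_units]
    have hprim : IsPrimitiveRoot (algebraMap F E g) (Fintype.card F - 1) := by
      rw [← hcard, ← hg]
      exact ((IsPrimitiveRoot.orderOf g).map_of_injective (f := Units.coeHom F)
        Units.val_injective).map_of_injective (algebraMap F E).injective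
    have : NeZero (Fintype.card F - 1) := ⟨by have := Fintype.one_lt_card (α := F); omega⟩
    obtain ⟨i, -, rfl⟩ := hprim.eq_pow_of_pow_eq_one hx
    exact ⟨g ^ i, by simp⟩

theorem natCast_ne_zero_of_coprime_card {F E : Type*} [Field F] [Fintype F] [Field E]
    [Algebra F E] {m : ℕ} (hco : Nat.Coprime m (Fintype.card F)) : (m : E) ≠ 0 := by
  obtain ⟨p, n, hp, hq⟩ := FiniteField.card' F
  intro h
  have hp0 : (Fintype.card F : E) = 0 := by
    rw [← map_natCast (algebraMap F E), FiniteField.cast_card_eq_zero, map_zero]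
  have := congrArg (fun z : ℤ => (z : E)) (Nat.isCoprime_iff_coprime.2 hco).choose_spec.choose_spec
  simp [h, hp0] at this

theorem dvd_mul_iff_div_gcd_dvd {m n : ℕ} [NeZero m] (z : ℤ) :
    (m : ℤ) ∣ z * n ↔ ((m / m.gcd n : ℕ) : ℤ) ∣ z := by
  rw [← Int.natAbs_dvd_natAbs, ← Int.natAbs_dvd_natAbs, Int.natAbs_mul]
  simp only [Int.natAbs_natCast]
  have hg : 0 < m.gcd n := Nat.gcd_pos_of_pos_left _ (NeZero.pos m)
  have hcop := Nat.coprime_div_gcd_div_gcd hg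
  constructor
  · intro h
    refine hcop.dvd_of_dvd_mul_right (Nat.dvd_of_mul_dvd_mul_right hg ?_)
    rwa [mul_assoc, Nat.div_mul_cancel (Nat.gcd_dvd_left m n),
      Nat.div_mul_cancel (Nat.gcd_dvd_right m n)]
  · intro h
    have := mul_dvd_mul h (Nat.gcd_dvd_right m n)
    rwa [Nat.div_mul_cancel (Nat.gcd_dvd_left m n)] at this

theorem shiftQC_zpow_eq_smul_iff {F E : Type*} [Field F] [Fintype F] [Field E] [Algebra F E]
    {m l it : ℕ} [NeZero m] (hco : Nat.Coprime m (Fintype.card F)) {ζ : E}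
    (hζ : IsPrimitiveRoot ζ m) {C : Submodule F ((ZMod m × Fin l) → F)}
    (hQC : ∀ c ∈ C, shiftQC F m l c ∈ C)
    (hmin : ∀ c ∈ C, ∀ v : Fin l,
      inMinIdeal (Fintype.card F) ζ it (fun i : ZMod m => c (i, v)))
    {c : ZMod m × Fin l → F} (hc : c ∈ C) (hc0 : c ≠ 0) (z : ℤ) (a : F) :
    (shiftQC F m l ^ z) c = a • c ↔
      algebraMap F E a = AddChar.zmodChar m hζ.pow_eq_one (z * it) := by
  have hm : (m : E) ≠ 0 := natCast_ne_zero_of_coprime_card (F := F) hco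
  have hD : ∀ v, evalDFT ζ (fun i => ((shiftQC F m l ^ z) c - a • c) (i, v)) it =
      (AddChar.zmodChar m hζ.pow_eq_one (z * it) - algebraMap F E a) *
        evalDFT ζ (fun i => c (i, v)) it := by
    intro v
    simp only [Pi.sub_apply, Pi.smul_apply, smul_eq_mul, shiftQC_zpow_apply]
    rw [evalDFT_sub, evalDFT_smul, evalDFT_shift hζ (fun i => c (i, v)), sub_mul]
  constructor
  · intro h
    by_contra hne
    apply hc0
    have hzero : ∀ v, (fun i => c (i, v)) = 0 := fun v =>
      eq_zero_of_inMinIdeal hζ hm (hmin c hc v) <| by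
        have := hD v
        rw [h, sub_self] at this
        have h0 : evalDFT ζ (fun i : ZMod m => (0 : ZMod m × Fin l → F) (i, v)) it = 0 := by
          simp [evalDFT]
        exact (mul_eq_zero.1 (this.symm.trans h0)).resolve_left (sub_ne_zero.2 (Ne.symm hne))
    ext ⟨i, v⟩
    exact congrFun (hzero v) i
  · intro h
    rw [← sub_eq_zero]
    ext ⟨i, v⟩
    refine congrFun (eq_zero_of_inMinIdeal hζ hm
      (hmin _ (C.sub_mem (shiftQC_zpow_mem hQC z hc) (C.smul_mem a hc)) v) ?_) i
    rw [hD, h, sub_self, zero_mul]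

theorem exists_shiftQC_zpow_eq_smul_iff {F E : Type*} [Field F] [Fintype F] [Field E]
    [Algebra F E] {m l it : ℕ} [NeZero m] (hco : Nat.Coprime m (Fintype.card F)) {ζ : E}
    (hζ : IsPrimitiveRoot ζ m) {C : Submodule F ((ZMod m × Fin l) → F)}
    (hQC : ∀ c ∈ C, shiftQC F m l c ∈ C)
    (hmin : ∀ c ∈ C, ∀ v : Fin l,
      inMinIdeal (Fintype.card F) ζ it (fun i : ZMod m => c (i, v)))
    {c : ZMod m × Fin l → F} (hc : c ∈ C) (hc0 : c ≠ 0) (z : ℤ) :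
    (∃ a : Fˣ, (shiftQC F m l ^ z) c = (a : F) • c) ↔
      ((m / m.gcd ((Fintype.card F - 1) * it) : ℕ) : ℤ) ∣ z := by
  simp_rw [shiftQC_zpow_eq_smul_iff hco hζ hQC hmin hc hc0]
  rw [exists_units_algebraMap_eq_iff, ← AddChar.map_nsmul_eq_pow,
    (AddChar.zmodChar_primitive_of_primitive_root m hζ).zmod_char_eq_one_iff,
    ← dvd_mul_iff_div_gcd_dvd, ← ZMod.intCast_zmod_eq_zero_iff_dvd, nsmul_eq_mul]
  push_cast
  ring_nf

end QuasiCyclicOrbits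

open QuasiCyclicOrbits in
/-- Let `C` be an `[lm, K]` quasi-cyclic code over `F_q` which is a linear
code over `R_m ε_t`.  Then the number of orbits of `⟨ρ^l, M⟩` on `C \ {0}` equals
`gcd(m, (q-1) i_t)(q^K - 1)/(m(q-1))`; in particular `s(C)` is at most this number, with
equality iff any two nonzero codewords of equal weight lie in the same `⟨ρ^l, M⟩`-orbit. -/
theorem orbits_shift_scalar_minimal_ideal {F E : Type*} [Field F] [Fintype F] [DecidableEq F]
    [Field E] [Algebra F E] {m l K k it : ℕ} [NeZero m] (hl : 2 ≤ l)
    (hco : Nat.Coprime m (Fintype.card F))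
    (ζ : E) (hζ : IsPrimitiveRoot ζ m)
    (C : Submodule F ((ZMod m × Fin l) → F))
    (hQC : ∀ c ∈ C, shiftQC F m l c ∈ C)
    (hmin : ∀ c ∈ C, ∀ v : Fin l,
      inMinIdeal (Fintype.card F) ζ it (fun i : ZMod m => c (i, v)))
    (hK : Module.finrank F ↥C = K)
    (hk : (cycCoset (Fintype.card F) m it).ncard = k)
    (N : ℕ)
    (hN : Set.ncard {O : Set ((ZMod m × Fin l) → F) | ∃ c, c ∈ C ∧ c ≠ 0 ∧
      O = {x | ∃ (z : ℤ) (a : Fˣ), (shiftQC F m l ^ z) ((a : F) • c) = x}} = N) :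
    (N : ℚ) = (Nat.gcd m ((Fintype.card F - 1) * it) * (Fintype.card F ^ K - 1) : ℕ) /
        ((m : ℚ) * (Fintype.card F - 1)) ∧
    Set.ncard {w : ℕ | ∃ c, c ∈ C ∧ c ≠ 0 ∧ hammingNorm c = w} ≤ N ∧
    (Set.ncard {w : ℕ | ∃ c, c ∈ C ∧ c ≠ 0 ∧ hammingNorm c = w} = N ↔
      ∀ c₁ c₂ : (ZMod m × Fin l) → F, c₁ ∈ C → c₂ ∈ C → c₁ ≠ 0 → c₂ ≠ 0 →
        hammingNorm c₁ = hammingNorm c₂ →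
          ∃ (z : ℤ) (a : Fˣ), (shiftQC F m l ^ z) ((a : F) • c₁) = c₂) := by
  set q := Fintype.card F with hq
  have hq1 : 1 < q := Fintype.one_lt_card
  set g := m.gcd ((q - 1) * it) with hg
  have hgm : m / g * g = m := Nat.div_mul_cancel (Nat.gcd_dvd_left _ _)
  have hd : 0 < m / g :=
    Nat.pos_of_ne_zero fun h => NeZero.ne m (by rw [← hgm, h, zero_mul])
  have hcount := ncard_linOrbits_mul (shiftQC F m l) C
    (by rintro c hc _ ⟨z, a, rfl⟩; exact shiftQC_zpow_mem hQC z (C.smul_mem _ hc))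
    (fun c hc hc0 => ncard_linOrbit (shiftQC F m l) hc0 hd
      (exists_shiftQC_zpow_eq_smul_iff hco hζ hQC hmin hc hc0))
  have hvals := ncard_values_le_linOrbits (shiftQC F m l) (fun c => c ∈ C ∧ c ≠ 0) hammingNorm
    (by rintro c _ ⟨z, a, rfl⟩; exact hammingNorm_shiftQC_zpow_smul z a c)
  simp only [linOrbit, and_assoc, Set.mem_ofPred_eq] at hcount hvals
  rw [hN] at hcount hvals
  refine ⟨?_, hvals.1, hvals.2.trans ⟨fun h c₁ c₂ h₁ h₂ n₁ n₂ => h c₁ c₂ ⟨h₁, n₁⟩ ⟨h₂, n₂⟩,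
    fun h c₁ c₂ h₁ h₂ => h c₁ c₂ h₁.1 h₂.1 h₁.2 h₂.2⟩⟩
  have hmain : N * (m * (q - 1)) = g * (q ^ K - 1) := by
    rw [← hK, ← hcount]
    conv_lhs => rw [← hgm]
    ring
  have hm0 : (m : ℚ) ≠ 0 := by exact_mod_cast NeZero.ne m
  have hq0 : (q : ℚ) - 1 ≠ 0 := sub_ne_zero.2 (by exact_mod_cast hq1.ne')
  rw [eq_div_iff (mul_ne_zero hm0 hq0), ← hmain]
  push_cast [Nat.cast_sub hq1.le]
  ring
end
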